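/- arXiv:2105.06146 — 2 statements merged into one kernel-verified Lean document; each statement's English description precedes it below -/
import Mathlib

section
/- Let ψ : [0, ∞) → [0, ∞) be smooth, monotone increasing with ψ(0) = 1. There exist continuous functions C, c : [0, ∞) → (0, ∞), depending only on ψ, with the following property. Let T > 0 and let u = (u1, u2, u3) : [0, T] × ℝ² → ℝ³ be a smooth solution of ∂_t u1 = ∂_2 u3, ∂_t u2 = −∂_1 u3, ∂_t u3 = ∂_2(ψ(u1² + u2²)·u1) − ∂_1(ψ(u1² + u2²)·u2) which vanishes for |x| ≥ R uniformly in t ∈ [0, T]. Set A = sup_{t ∈ [0,T]} ‖u(t)‖_{L^∞(ℝ²)} and B(t) = ‖∇_x u(t)‖_{L^∞(ℝ²)}. Then for all t ∈ [0, T]: ‖u(t)‖_{L²(ℝ²)}² ≤ C(A) · exp( c(A) ∫_0^t B(s) ds ) · ‖u(0)‖_{L²(ℝ²)}². -/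
open MeasureTheory

/-- Partial derivative of `f : ℝⁿ → ℝ` in the `i`-th coordinate direction. -/
noncomputable def pd {n : ℕ} (i : Fin n) (f : (Fin n → ℝ) → ℝ) (x : Fin n → ℝ) : ℝ :=
  fderiv ℝ f x (Pi.single i 1)


/-- Square face of side `2|R|`. -/
noncomputable def bx (R : ℝ) : Set (Fin 2 → ℝ) := Set.Icc (fun _ => -|R|) (fun _ => |R|)

lemma out_of_bx {R : ℝ} {x : Fin 2 → ℝ} (hx : x ∉ bx R) :
    R ≤ Real.sqrt ((x 0) ^ 2 + (x 1) ^ 2) := by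
  by_contra hlt
  push Not at hlt
  apply hx
  have h0 : |x 0| ≤ |R| := by
    refine le_trans ?_ (hlt.le.trans (le_abs_self R))
    rw [← Real.sqrt_sq_eq_abs]
    exact Real.sqrt_le_sqrt (by nlinarith [sq_nonneg (x 1)])
  have h1 : |x 1| ≤ |R| := by
    refine le_trans ?_ (hlt.le.trans (le_abs_self R))
    rw [← Real.sqrt_sq_eq_abs]
    exact Real.sqrt_le_sqrt (by nlinarith [sq_nonneg (x 0)])
  rw [abs_le] at h0 h1
  constructor
  · intro i
    fin_cases i
    · exact h0.1
    · exact h1.1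
  · intro i
    fin_cases i
    · exact h0.2
    · exact h1.2

lemma side_le {R a b : ℝ} (h : |a| = |R| ∨ |b| = |R|) :
    R ≤ Real.sqrt (a ^ 2 + b ^ 2) := by
  refine (le_abs_self R).trans ?_
  rcases h with h | h <;> rw [← h, ← Real.sqrt_sq_eq_abs] <;> apply Real.sqrt_le_sqrt
  · nlinarith [sq_nonneg b]
  · nlinarith [sq_nonneg a]

lemma conservation (f : Fin 3 → (Fin 3 → ℝ) → ℝ) (hf : ∀ i, Differentiable ℝ (f i))
    (T R : ℝ)
    (hdiv : ∀ w : Fin 3 → ℝ, w 0 ∈ Set.Icc (0 : ℝ) T →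
      ∑ i, fderiv ℝ (f i) w (Pi.single i 1) = 0)
    (hsupp : ∀ w : Fin 3 → ℝ, w 0 ∈ Set.Icc (0 : ℝ) T →
      R ≤ Real.sqrt ((w 1) ^ 2 + (w 2) ^ 2) → ∀ i, f i w = 0)
    (t : ℝ) (ht : t ∈ Set.Icc (0 : ℝ) T) :
    ∫ x in bx R, f 0 ![t, x 0, x 1] = ∫ x in bx R, f 0 ![0, x 0, x 1] := by
  set a : Fin 3 → ℝ := ![0, -|R|, -|R|] with ha
  set b : Fin 3 → ℝ := ![t, |R|, |R|] with hb
  have hR := abs_nonneg R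
  have hle : a ≤ b := by
    intro i
    fin_cases i
    · exact ht.1
    · simp [ha, hb]
    · simp [ha, hb]
  have hz : ∀ w ∈ Set.Icc a b, w 0 ∈ Set.Icc (0 : ℝ) T := by
    intro w hw
    exact ⟨hw.1 0, (hw.2 0).trans ht.2⟩
  have hzero : ∀ w ∈ Set.Icc a b, (∑ i, fderiv ℝ (f i) w (Pi.single i 1)) = 0 :=
    fun w hw => hdiv w (hz w hw)
  have key := integral_divergence_of_hasFDerivAt_off_countable' a b hle f
    (fun i w => fderiv ℝ (f i) w) ∅ Set.countable_empty
    (fun i => (hf i).continuous.continuousOn) (fun w _ i => (hf i w).hasFDerivAt)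
    ((integrableOn_zero (ε' := ℝ)).congr_fun (fun w hw => (hzero w hw).symm) measurableSet_Icc)
  rw [setIntegral_congr_fun measurableSet_Icc hzero] at key
  have hside : ∀ i : Fin 3, i ≠ 0 → ∀ c : ℝ, |c| = |R| →
      ∫ x in Set.Icc (a ∘ Fin.succAbove i) (b ∘ Fin.succAbove i), f i (Fin.insertNth i c x) = 0 := by
    intro i hi c hc
    apply setIntegral_eq_zero_of_forall_eq_zero
    intro x hx
    have hx0 : x 0 ∈ Set.Icc (0 : ℝ) T := by
      have h1 := hx.1 0
      have h2 := hx.2 0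
      have : Fin.succAbove i (0 : Fin 2) = 0 := by
        fin_cases i <;> first | rfl | exact absurd rfl hi
      simp only [Function.comp_apply, this] at h1 h2
      exact ⟨h1, h2.trans ht.2⟩
    fin_cases i
    · exact absurd rfl hi
    · exact hsupp (Fin.insertNth (1 : Fin 3) c x) hx0 (side_le (Or.inl hc)) 1
    · exact hsupp (Fin.insertNth (2 : Fin 3) c x) hx0 (side_le (Or.inr hc)) 2
  rw [Fin.sum_univ_three, hside 1 (by decide) (b 1) (by simp [hb]),
    hside 1 (by decide) (a 1) (by simp [ha]), hside 2 (by decide) (b 2) (by simp [hb]),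
    hside 2 (by decide) (a 2) (by simp [ha])] at key
  simp only [integral_zero, sub_zero, add_zero] at key
  have hface : Set.Icc (a ∘ Fin.succAbove 0) (b ∘ Fin.succAbove 0) = bx R := by
    unfold bx
    congr 1 <;> funext i <;> fin_cases i <;> rfl
  rw [hface] at key
  have hins : ∀ (c : ℝ) (x : Fin 2 → ℝ), Fin.insertNth (α := fun _ => ℝ) (0 : Fin 3) c x = ![c, x 0, x 1] := by
    intro c x
    funext i
    fin_cases i <;> rfl
  simp only [hins] at key
  exact (sub_eq_zero.1 key.symm)

lemma F_bounds (ψ : ℝ → ℝ) (hc : Continuous ψ) (hψmono : MonotoneOn ψ (Set.Ici 0))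
    (hψ0 : ψ 0 = 1) (r K : ℝ) (hr : 0 ≤ r) (hK : r ≤ K) :
    r ≤ (∫ s in (0:ℝ)..r, ψ s) ∧ (∫ s in (0:ℝ)..r, ψ s) ≤ ψ K * r := by
  constructor
  · have := intervalIntegral.integral_mono_on (μ := volume) (f := fun _ => (1:ℝ)) (g := ψ) hr
      (by simp) (hc.intervalIntegrable _ _)
      (fun x hx => hψ0 ▸ hψmono (Set.mem_Ici.2 le_rfl) (Set.mem_Ici.2 hx.1) hx.1)
    simpa using this
  · have := intervalIntegral.integral_mono_on (μ := volume) (f := ψ) (g := fun _ => ψ K) hr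
      (hc.intervalIntegrable _ _) (by simp)
      (fun x hx => hψmono (Set.mem_Ici.2 hx.1) (Set.mem_Ici.2 (hr.trans hK)) (hx.2.trans hK))
    simpa [mul_comm] using this

lemma le_A (T R : ℝ) (u : (Fin 3 → ℝ) → Fin 3 → ℝ) (hu : Continuous u)
    (hsupp : ∀ w : Fin 3 → ℝ, w 0 ∈ Set.Icc (0 : ℝ) T →
          R ≤ Real.sqrt ((w 1) ^ 2 + (w 2) ^ 2) → u w = 0)
    (w : Fin 3 → ℝ) (hw : w 0 ∈ Set.Icc (0 : ℝ) T) (i : Fin 3) :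
    |u w i| ≤ ⨆ w : Fin 3 → ℝ, ⨆ _ : w 0 ∈ Set.Icc (0 : ℝ) T, ⨆ i : Fin 3, |u w i| := by
  obtain ⟨M, hM⟩ := (isCompact_Icc (a := (![0, -|R|, -|R|] : Fin 3 → ℝ))
    (b := ![T, |R|, |R|])).exists_bound_of_continuousOn hu.continuousOn
  have hM' : ∀ w : Fin 3 → ℝ, w 0 ∈ Set.Icc (0 : ℝ) T → ∀ i, |u w i| ≤ max M 0 := by
    intro w hw i
    by_cases hx : ![w 1, w 2] ∈ bx R
    · refine (norm_le_pi_norm (u w) i).trans ((hM w ⟨?_, ?_⟩).trans (le_max_left _ _))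
      · intro j
        fin_cases j
        · exact hw.1
        · exact hx.1 0
        · exact hx.1 1
      · intro j
        fin_cases j
        · exact hw.2
        · exact hx.2 0
        · exact hx.2 1
    · have := out_of_bx hx
      rw [hsupp w hw this]
      simp
  have hbdd : BddAbove (Set.range fun w : Fin 3 → ℝ =>
      ⨆ _ : w 0 ∈ Set.Icc (0 : ℝ) T, ⨆ i : Fin 3, |u w i|) := by
    refine ⟨max M 0, ?_⟩
    rintro _ ⟨w, rfl⟩
    exact Real.iSup_le (fun h => Real.iSup_le (hM' w h) (le_max_right _ _)) (le_max_right _ _)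
  refine le_trans ?_ (le_ciSup hbdd w)
  rw [ciSup_pos hw]
  exact le_ciSup (f := fun i => |u w i|) (Set.finite_range _).bddAbove i

/-- `L²` energy estimate for smooth, spatially compactly supported solutions
of the quasilinear 2d Maxwell system with Kerr-type law `ε⁻¹(u) = ψ(u1² + u2²)`. -/
theorem statement18
    (ψ : ℝ → ℝ) (hψ : ContDiff ℝ (⊤ : ℕ∞) ψ) (hψmono : MonotoneOn ψ (Set.Ici 0))
    (hψ0 : ψ 0 = 1) (hψnonneg : ∀ s : ℝ, 0 ≤ s → 0 ≤ ψ s) :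
    ∃ C c : ℝ → ℝ, ContinuousOn C (Set.Ici 0) ∧ ContinuousOn c (Set.Ici 0) ∧
      (∀ A : ℝ, 0 ≤ A → 0 < C A ∧ 0 < c A) ∧
      ∀ (T : ℝ), 0 < T →
      ∀ (R : ℝ) (u : (Fin 3 → ℝ) → Fin 3 → ℝ), ContDiff ℝ (⊤ : ℕ∞) u →
        (∀ w : Fin 3 → ℝ, w 0 ∈ Set.Icc (0 : ℝ) T →
          pd 0 (fun y => u y 0) w = pd 2 (fun y => u y 2) w ∧
          pd 0 (fun y => u y 1) w = -(pd 1 (fun y => u y 2) w) ∧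
          pd 0 (fun y => u y 2) w =
            pd 2 (fun y => ψ ((u y 0) ^ 2 + (u y 1) ^ 2) * u y 0) w
            - pd 1 (fun y => ψ ((u y 0) ^ 2 + (u y 1) ^ 2) * u y 1) w) →
        (∀ w : Fin 3 → ℝ, w 0 ∈ Set.Icc (0 : ℝ) T →
          R ≤ Real.sqrt ((w 1) ^ 2 + (w 2) ^ 2) → u w = 0) →
        -- `A = sup_{t ∈ [0,T]} ‖u(t)‖_{L∞}` and `B(t) = ‖∇_x u(t)‖_{L∞}`
        (let A : ℝ := ⨆ w : Fin 3 → ℝ, ⨆ _ : w 0 ∈ Set.Icc (0 : ℝ) T, ⨆ i : Fin 3, |u w i|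
         let B : ℝ → ℝ := fun s =>
           ⨆ x : Fin 2 → ℝ, ⨆ i : Fin 3, ⨆ j : Fin 2,
             |fderiv ℝ (fun w => u w i) ![s, x 0, x 1] (Pi.single j.succ 1)|
         ∀ t ∈ Set.Icc (0 : ℝ) T,
           (∫ x : Fin 2 → ℝ, ∑ i : Fin 3, (u ![t, x 0, x 1] i) ^ 2)
             ≤ C A * Real.exp (c A * ∫ s in (0:ℝ)..t, B s)
               * ∫ x : Fin 2 → ℝ, ∑ i : Fin 3, (u ![0, x 0, x 1] i) ^ 2) := by
  have hψc : Continuous ψ := hψ.continuous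
  have hψ1 : ∀ s, 0 ≤ s → 1 ≤ ψ s := fun s hs =>
    hψ0 ▸ hψmono (Set.mem_Ici.2 le_rfl) (Set.mem_Ici.2 hs) hs
  refine ⟨fun A => ψ (2 * A ^ 2), fun _ => 1, by fun_prop, by fun_prop,
    fun A _ => ⟨lt_of_lt_of_le one_pos (hψ1 _ (by positivity)), one_pos⟩, ?_⟩
  intro T hT R u hu hpde hsupp A B t ht
  have huc := hu.continuous
  have hud : ∀ i, Differentiable ℝ (fun y => u y i) := fun i =>
    differentiable_pi.1 (hu.differentiable (by simp)) i
  have hψd : Differentiable ℝ ψ := hψ.differentiable (by simp)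
  have hA : ∀ w : Fin 3 → ℝ, w 0 ∈ Set.Icc (0 : ℝ) T → ∀ i, |u w i| ≤ A :=
    fun w hw i => le_A T R u huc hsupp w hw i
  have hB : ∀ s, 0 ≤ B s := fun s => Real.iSup_nonneg fun x => Real.iSup_nonneg fun i =>
    Real.iSup_nonneg fun j => abs_nonneg _
  have hexp : 1 ≤ Real.exp (1 * ∫ s in (0:ℝ)..t, B s) := by
    apply Real.one_le_exp
    rw [one_mul]
    exact intervalIntegral.integral_nonneg ht.1 fun s _ => hB s
  have hC1 : 1 ≤ ψ (2 * A ^ 2) := hψ1 _ (by positivity)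
  set F : ℝ → ℝ := fun r => ∫ s in (0:ℝ)..r, ψ s with hF
  have hFd : ∀ r, HasDerivAt F (ψ r) r := fun r =>
    intervalIntegral.integral_hasDerivAt_right (hψc.intervalIntegrable _ _)
      (hψc.stronglyMeasurableAtFilter _ _) hψc.continuousAt
  have hFdiff : Differentiable ℝ F := fun r => (hFd r).differentiableAt
  set P : Fin 3 → (Fin 3 → ℝ) → ℝ := fun i y => ψ ((u y 0) ^ 2 + (u y 1) ^ 2) * u y i with hP
  have hud0 := hud 0
  have hud1 := hud 1
  have hud2 := hud 2
  have hPd : ∀ i, Differentiable ℝ (P i) := by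
    intro i
    have := hud i
    exact (hψd.comp (by fun_prop : Differentiable ℝ fun y => (u y 0) ^ 2 + (u y 1) ^ 2)).mul this
  set f : Fin 3 → (Fin 3 → ℝ) → ℝ :=
    ![fun y => (u y 2) ^ 2 + F ((u y 0) ^ 2 + (u y 1) ^ 2),
      fun y => 2 * (u y 2 * P 1 y), fun y => -2 * (u y 2 * P 0 y)] with hf
  have hfd : ∀ w (_ : ℝ),
      HasFDerivAt (f 0) ((2 * u w 2) • fderiv ℝ (fun y => u y 2) w +
        ψ ((u w 0) ^ 2 + (u w 1) ^ 2) • ((2 * u w 0) • fderiv ℝ (fun y => u y 0) w +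
          (2 * u w 1) • fderiv ℝ (fun y => u y 1) w)) w ∧
      HasFDerivAt (f 1) ((2 : ℝ) • (u w 2 • fderiv ℝ (P 1) w + P 1 w • fderiv ℝ (fun y => u y 2) w)) w ∧
      HasFDerivAt (f 2) ((-2 : ℝ) • (u w 2 • fderiv ℝ (P 0) w + P 0 w • fderiv ℝ (fun y => u y 2) w)) w := by
    intro w _
    have d0 := (hud 0 w).hasFDerivAt
    have d1 := (hud 1 w).hasFDerivAt
    have d2 := (hud 2 w).hasFDerivAt
    refine ⟨?_, ?_, ?_⟩
    · have h2 := d2.pow 2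
      have h01 := (d0.pow 2).add (d1.pow 2)
      have h := h2.add ((hFd _).comp_hasFDerivAt w h01)
      refine h.congr_fderiv ?_
      ext v
      simp
    · exact (d2.mul (hPd 1 w).hasFDerivAt).const_mul 2
    · exact (d2.mul (hPd 0 w).hasFDerivAt).const_mul (-2)
  have hfdiff : ∀ i, Differentiable ℝ (f i) := by
    intro i w
    fin_cases i
    · exact (hfd w 0).1.differentiableAt
    · exact (hfd w 0).2.1.differentiableAt
    · exact (hfd w 0).2.2.differentiableAt
  have hF0 : F 0 = 0 := by simp [hF]
  have hcons := conservation f hfdiff T R (by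
      intro w hw
      obtain ⟨e0, e1, e2⟩ := hpde w hw
      obtain ⟨g0, g1, g2⟩ := hfd w 0
      rw [Fin.sum_univ_three, g0.fderiv, g1.fderiv, g2.fderiv]
      change fderiv ℝ (fun y => u y 0) w (Pi.single 0 1) = fderiv ℝ (fun y => u y 2) w (Pi.single 2 1) at e0
      change fderiv ℝ (fun y => u y 1) w (Pi.single 0 1) = -fderiv ℝ (fun y => u y 2) w (Pi.single 1 1) at e1
      change fderiv ℝ (fun y => u y 2) w (Pi.single 0 1) = fderiv ℝ (P 0) w (Pi.single 2 1)
        - fderiv ℝ (P 1) w (Pi.single 1 1) at e2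
      simp only [_root_.add_apply, _root_.smul_apply, smul_eq_mul, e0, e1, e2]
      simp only [hP]
      ring) (by
      intro w hw hR i
      have h0 := hsupp w hw hR
      fin_cases i <;> simp [hf, hP, h0, hF0]) t ht
  have hred : ∀ s ∈ Set.Icc (0:ℝ) T, (∫ x : Fin 2 → ℝ, ∑ i : Fin 3, (u ![s, x 0, x 1] i) ^ 2)
      = ∫ x in bx R, ∑ i : Fin 3, (u ![s, x 0, x 1] i) ^ 2 := by
    intro s hs
    symm
    apply setIntegral_eq_integral_of_forall_compl_eq_zero
    intro x hx
    have := hsupp ![s, x 0, x 1] hs (out_of_bx hx)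
    simp [this]
  have h0T : (0:ℝ) ∈ Set.Icc (0:ℝ) T := ⟨le_rfl, hT.le⟩
  have hvc : ∀ s : ℝ, Continuous fun x : Fin 2 → ℝ => (![s, x 0, x 1] : Fin 3 → ℝ) := by
    intro s
    fun_prop
  have hint : ∀ g : (Fin 3 → ℝ) → ℝ, Continuous g → ∀ s : ℝ,
      IntegrableOn (fun x : Fin 2 → ℝ => g ![s, x 0, x 1]) (bx R) := fun g hg s =>
    (hg.comp (hvc s)).continuousOn.integrableOn_compact isCompact_Icc
  have hcu : Continuous fun w => ∑ i : Fin 3, (u w i) ^ 2 := by fun_prop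
  rw [hred t ht, hred 0 h0T]
  have hbnd : ∀ w : Fin 3 → ℝ, w 0 ∈ Set.Icc (0:ℝ) T →
      (∑ i : Fin 3, (u w i) ^ 2) ≤ f 0 w ∧ f 0 w ≤ ψ (2 * A ^ 2) * ∑ i : Fin 3, (u w i) ^ 2 := by
    intro w hw
    have h0 := sq_le_sq' (abs_le.1 (hA w hw 0)).1 (abs_le.1 (hA w hw 0)).2
    have h1 := sq_le_sq' (abs_le.1 (hA w hw 1)).1 (abs_le.1 (hA w hw 1)).2
    obtain ⟨b1, b2⟩ := F_bounds ψ hψc hψmono hψ0 ((u w 0) ^ 2 + (u w 1) ^ 2) (2 * A ^ 2)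
      (by positivity) (by linarith)
    rw [Fin.sum_univ_three]
    change _ ≤ (u w 2) ^ 2 + F _ ∧ (u w 2) ^ 2 + F _ ≤ _
    constructor
    · linarith
    · nlinarith [mul_nonneg (sub_nonneg.2 hC1) (sq_nonneg (u w 2))]
  have hfc := (hfdiff 0).continuous
  have hnn : 0 ≤ ∫ x in bx R, ∑ i : Fin 3, (u ![0, x 0, x 1] i) ^ 2 :=
    integral_nonneg fun x => Finset.sum_nonneg fun i _ => sq_nonneg _
  calc ∫ x in bx R, ∑ i : Fin 3, (u ![t, x 0, x 1] i) ^ 2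
      ≤ ∫ x in bx R, f 0 ![t, x 0, x 1] :=
        setIntegral_mono_on (hint _ hcu t) (hint _ hfc t) measurableSet_Icc
          fun x _ => (hbnd ![t, x 0, x 1] ht).1
    _ = ∫ x in bx R, f 0 ![0, x 0, x 1] := hcons
    _ ≤ ∫ x in bx R, ψ (2 * A ^ 2) * ∑ i : Fin 3, (u ![0, x 0, x 1] i) ^ 2 :=
        setIntegral_mono_on (hint _ hfc 0) ((hint _ hcu 0).const_mul _) measurableSet_Icc
          fun x _ => (hbnd ![0, x 0, x 1] h0T).2
    _ = ψ (2 * A ^ 2) * ∫ x in bx R, ∑ i : Fin 3, (u ![0, x 0, x 1] i) ^ 2 :=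
        integral_const_mul _ _
    _ ≤ ψ (2 * A ^ 2) * Real.exp (1 * ∫ s in (0:ℝ)..t, B s)
          * ∫ x in bx R, ∑ i : Fin 3, (u ![0, x 0, x 1] i) ^ 2 := by
        apply mul_le_mul_of_nonneg_right _ hnn
        exact le_mul_of_one_le_right (zero_le_one.trans hC1) hexp
end

section
/- Let ψ : [0, ∞) → [0, ∞) be smooth, monotone increasing with ψ(0) = 1. There exist continuous functions C, c : [0, ∞) → (0, ∞), depending only on ψ, with the following property. Let T > 0 and let u¹, u² : [0, T] × ℝ² → ℝ³ be two smooth solutions of the quasilinear Maxwell system ∂_t u1 = ∂_2 u3, ∂_t u2 = −∂_1 u3, ∂_t u3 = ∂_2(ψ(u1² + u2²)·u1) − ∂_1(ψ(u1² + u2²)·u2), both vanishing for |x| ≥ R uniformly in t ∈ [0, T]. Set A = sup_{t ∈ [0,T]} (‖u¹(t)‖_{L^∞} + ‖u²(t)‖_{L^∞}), B(t) = ‖∇_x u¹(t)‖_{L^∞} + ‖∇_x u²(t)‖_{L^∞}, and v = u¹ − u². Then for all t ∈ [0, T]: ‖v(t)‖_{L²(ℝ²)}² ≤ C(A) · exp(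 c(A) ∫_0^t B(s) ds ) · ‖v(0)‖_{L²(ℝ²)}². -/
open MeasureTheory

/-- The quasilinear 2d Maxwell system with Kerr-type law `ε⁻¹(u) = ψ(u1² + u2²)`,
required for times `t ∈ [0, T]`. -/
def IsMaxwellSol (ψ : ℝ → ℝ) (T : ℝ) (u : (Fin 3 → ℝ) → Fin 3 → ℝ) : Prop :=
  ∀ w : Fin 3 → ℝ, w 0 ∈ Set.Icc (0 : ℝ) T →
    pd 0 (fun y => u y 0) w = pd 2 (fun y => u y 2) w ∧
    pd 0 (fun y => u y 1) w = -(pd 1 (fun y => u y 2) w) ∧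
    pd 0 (fun y => u y 2) w =
      pd 2 (fun y => ψ ((u y 0) ^ 2 + (u y 1) ^ 2) * u y 0) w
      - pd 1 (fun y => ψ ((u y 0) ^ 2 + (u y 1) ^ 2) * u y 1) w


lemma taylor1 (ψ : ℝ → ℝ) (hψ : ContDiff ℝ (⊤ : ℕ∞) ψ) {X M : ℝ}
    (hM : ∀ s ∈ Set.Icc 0 X, |deriv ψ s| ≤ M) {S s : ℝ}
    (hS : S ∈ Set.Icc 0 X) (hs : s ∈ Set.Icc 0 X) : |ψ S - ψ s| ≤ M * |S - s| := by
  have hd : Differentiable ℝ ψ := hψ.differentiable (by simp)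
  exact Convex.norm_image_sub_le_of_norm_hasDerivWithin_le (f := ψ) (f' := deriv ψ)
    (fun x _ => (hd x).hasDerivAt.hasDerivWithinAt) (fun x hx => hM x hx) (convex_Icc 0 X) hs hS

lemma taylor2 (ψ : ℝ → ℝ) (hψ : ContDiff ℝ (⊤ : ℕ∞) ψ) {X M : ℝ}
    (hM : ∀ s ∈ Set.Icc 0 X, |deriv (deriv ψ) s| ≤ M) {S s : ℝ}
    (hS : S ∈ Set.Icc 0 X) (hs : s ∈ Set.Icc 0 X) :
    |ψ S - ψ s - deriv ψ s * (S - s)| ≤ M * (S - s) ^ 2 := by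
  have hd : Differentiable ℝ ψ := hψ.differentiable (by simp)
  have hψ' : ContDiff ℝ (⊤ : ℕ∞) (deriv ψ) := (contDiff_infty_iff_deriv.1 hψ).2
  have hM0 : 0 ≤ M := (abs_nonneg _).trans (hM s hs)
  have hsub : Set.uIcc s S ⊆ Set.Icc 0 X := Set.uIcc_subset_Icc hs hS
  have key := Convex.norm_image_sub_le_of_norm_hasDerivWithin_le
    (f := fun x => ψ x - deriv ψ s * x) (f' := fun x => deriv ψ x - deriv ψ s) (C := M * |S - s|)
    (s := Set.uIcc s S) (x := s) (y := S)
    (fun x _ => by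
      have := ((hd x).hasDerivAt.sub ((hasDerivAt_id x).const_mul (deriv ψ s))).hasDerivWithinAt
        (s := Set.uIcc s S)
      rw [mul_one] at this
      exact this)
    (fun x hx => by
      have h1 := taylor1 (deriv ψ) hψ' hM (hsub hx) hs
      refine h1.trans ?_
      have : |x - s| ≤ |S - s| := Set.abs_sub_left_of_mem_uIcc hx
      gcongr)
    (convex_uIcc s S) Set.left_mem_uIcc Set.right_mem_uIcc
  rw [Real.norm_eq_abs, Real.norm_eq_abs, mul_assoc, abs_mul_abs_self] at key
  calc _ = |ψ S - deriv ψ s * S - (ψ s - deriv ψ s * s)| := by congr 1; ring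
    _ ≤ _ := key
    _ = _ := by ring

lemma alg_rem {A B M1 M2 p q q' a1 a2 b1 b2 d1 d2 : ℝ} (hM2 : 0 ≤ M2)
    (h1 : |a1| + |b1| ≤ A) (h2 : |a2| + |b2| ≤ A) (hd1 : |d1| ≤ B) (hd2 : |d2| ≤ B)
    (hq' : |q'| ≤ M1)
    (hp : |p - q - q' * ((a1^2+a2^2) - (b1^2+b2^2))| ≤ M2 * ((a1^2+a2^2) - (b1^2+b2^2))^2) :
    |q * ((a1-b1)*d1+(a2-b2)*d2) + 2*q'*(b1*d1+b2*d2)*(b1*(a1-b1)+b2*(a2-b2))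
      - ((p*a1-q*b1)*d1 + (p*a2-q*b2)*d2)|
      ≤ (4*A^3*M2 + 6*A*M1) * B * ((a1-b1)^2+(a2-b2)^2) := by
  have hA : 0 ≤ A := le_trans (by positivity) h1
  have hB : 0 ≤ B := le_trans (by positivity) hd1
  have hM1 : 0 ≤ M1 := le_trans (by positivity) hq'
  have ha1 : |a1| ≤ A := by linarith [abs_nonneg b1]
  have hb1 : |b1| ≤ A := by linarith [abs_nonneg a1]
  have ha2 : |a2| ≤ A := by linarith [abs_nonneg b2]
  have hb2 : |b2| ≤ A := by linarith [abs_nonneg a2]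
  have hab1 : |a1 + b1| ≤ A := (abs_add_le _ _).trans h1
  have hab2 : |a2 + b2| ≤ A := (abs_add_le _ _).trans h2
  set W := (a1-b1)^2+(a2-b2)^2 with hW
  have hW0 : 0 ≤ W := by positivity
  have had : |a1*d1+a2*d2| ≤ 2*A*B := by
    refine (abs_add_le _ _).trans ?_
    rw [abs_mul, abs_mul]
    have := mul_le_mul ha1 hd1 (abs_nonneg _) hA
    have := mul_le_mul ha2 hd2 (abs_nonneg _) hA
    linarith
  have hSs : ((a1^2+a2^2) - (b1^2+b2^2))^2 ≤ 2*A^2*W := by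
    have e1 : ((a1^2+a2^2) - (b1^2+b2^2))^2 ≤ ((a1+b1)^2+(a2+b2)^2)*W := by
      rw [hW]; nlinarith [sq_nonneg ((a1+b1)*(a2-b2)-(a2+b2)*(a1-b1))]
    have e2 : (a1+b1)^2 ≤ A^2 := sq_le_sq.2 (by rwa [abs_of_nonneg hA])
    have e3 : (a2+b2)^2 ≤ A^2 := sq_le_sq.2 (by rwa [abs_of_nonneg hA])
    refine e1.trans ?_
    apply mul_le_mul_of_nonneg_right _ hW0
    linarith
  have hcs : ∀ x1 x2 Y : ℝ, 0 ≤ Y → |x1| ≤ Y → |x2| ≤ Y → 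
      (x1*(a1-b1)+x2*(a2-b2))^2 ≤ 2*Y^2*W := by
    intro x1 x2 Y hY hx1 hx2
    have e1 : (x1*(a1-b1)+x2*(a2-b2))^2 ≤ (x1^2+x2^2)*W := by
      rw [hW]; nlinarith [sq_nonneg (x1*(a2-b2)-x2*(a1-b1))]
    have e2 : x1^2 ≤ Y^2 := sq_le_sq.2 (by rwa [abs_of_nonneg hY])
    have e3 : x2^2 ≤ Y^2 := sq_le_sq.2 (by rwa [abs_of_nonneg hY])
    refine e1.trans ?_
    apply mul_le_mul_of_nonneg_right _ hW0
    linarith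
  have hbw : |(b1*(a1-b1)+b2*(a2-b2)) * (d1*(a1-b1)+d2*(a2-b2))| ≤ 2*A*B*W := by
    have := mul_le_mul (hcs b1 b2 A hA hb1 hb2) (hcs d1 d2 B hB hd1 hd2) (sq_nonneg _)
      (by positivity)
    apply abs_le_of_sq_le_sq _ (by positivity)
    rw [mul_pow]
    refine this.trans (le_of_eq (by ring))
  have hid : q * ((a1-b1)*d1+(a2-b2)*d2) + 2*q'*(b1*d1+b2*d2)*(b1*(a1-b1)+b2*(a2-b2))
      - ((p*a1-q*b1)*d1 + (p*a2-q*b2)*d2)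
      = - ((p - q - q' * ((a1^2+a2^2) - (b1^2+b2^2))) * (a1*d1+a2*d2)
        + q' * (W * (a1*d1+a2*d2)
          + 2 * ((b1*(a1-b1)+b2*(a2-b2)) * (d1*(a1-b1)+d2*(a2-b2))))) := by
    rw [hW]; ring
  rw [hid, abs_neg]
  refine (abs_add_le _ _).trans ?_
  rw [abs_mul, abs_mul]
  have t1 : |p - q - q' * ((a1^2+a2^2) - (b1^2+b2^2))| * |a1*d1+a2*d2|
      ≤ (M2 * (2*A^2*W)) * (2*A*B) :=
    mul_le_mul (hp.trans (mul_le_mul_of_nonneg_left hSs hM2)) had (abs_nonneg _) (by positivity)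
  have t2 : |W * (a1*d1+a2*d2)
          + 2 * ((b1*(a1-b1)+b2*(a2-b2)) * (d1*(a1-b1)+d2*(a2-b2)))| ≤ 6*A*B*W := by
    refine (abs_add_le _ _).trans ?_
    rw [abs_mul, abs_mul 2, abs_of_nonneg hW0, abs_two]
    have := mul_le_mul_of_nonneg_left had hW0
    linarith
  have t3 := mul_le_mul hq' t2 (abs_nonneg _) hM1
  refine (add_le_add t1 t3).trans (le_of_eq (by ring))

lemma alg_low {p q a1 a2 b1 b2 : ℝ} (hp : 1 ≤ p) (hq : 1 ≤ q)
    (hm : 0 ≤ (p - q) * ((a1^2+a2^2) - (b1^2+b2^2))) :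
    (a1-b1)^2+(a2-b2)^2 ≤ (a1-b1)*(p*a1-q*b1) + (a2-b2)*(p*a2-q*b2) := by
  have : (a1-b1)*(p*a1-q*b1) + (a2-b2)*(p*a2-q*b2)
    = (p+q)/2*((a1-b1)^2+(a2-b2)^2) + (p - q) * ((a1^2+a2^2) - (b1^2+b2^2))/2 := by ring
  rw [this]
  nlinarith [sq_nonneg (a1-b1), sq_nonneg (a2-b2)]

lemma alg_up {A M0 M1 p q a1 a2 b1 b2 : ℝ} (hp : p ≤ M0) (hq : q ≤ M0) (hM1 : 0 ≤ M1)
    (h1 : |a1| + |b1| ≤ A) (h2 : |a2| + |b2| ≤ A)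
    (hm : |p - q| ≤ M1 * |(a1^2+a2^2) - (b1^2+b2^2)|) :
    (a1-b1)*(p*a1-q*b1) + (a2-b2)*(p*a2-q*b2) ≤ (M0 + M1*A^2) * ((a1-b1)^2+(a2-b2)^2) := by
  have hA : 0 ≤ A := le_trans (by positivity) h1
  have hab1 : |a1 + b1| ≤ A := (abs_add_le _ _).trans h1
  have hab2 : |a2 + b2| ≤ A := (abs_add_le _ _).trans h2
  set W := (a1-b1)^2+(a2-b2)^2 with hW
  have hW0 : 0 ≤ W := by positivity
  have hSs : ((a1^2+a2^2) - (b1^2+b2^2))^2 ≤ 2*A^2*W := by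
    have e1 : ((a1^2+a2^2) - (b1^2+b2^2))^2 ≤ ((a1+b1)^2+(a2+b2)^2)*W := by
      rw [hW]; nlinarith [sq_nonneg ((a1+b1)*(a2-b2)-(a2+b2)*(a1-b1))]
    have e2 : (a1+b1)^2 ≤ A^2 := sq_le_sq.2 (by rwa [abs_of_nonneg hA])
    have e3 : (a2+b2)^2 ≤ A^2 := sq_le_sq.2 (by rwa [abs_of_nonneg hA])
    refine e1.trans ?_
    apply mul_le_mul_of_nonneg_right _ hW0
    linarith
  have : (a1-b1)*(p*a1-q*b1) + (a2-b2)*(p*a2-q*b2)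
    = (p+q)/2*W + (p - q) * ((a1^2+a2^2) - (b1^2+b2^2))/2 := by rw [hW]; ring
  rw [this]
  have k1 : (p - q) * ((a1^2+a2^2) - (b1^2+b2^2)) ≤ M1 * (2*A^2*W) := by
    refine (le_abs_self _).trans ?_
    rw [abs_mul]
    refine (mul_le_mul_of_nonneg_right hm (abs_nonneg _)).trans ?_
    rw [mul_assoc, abs_mul_abs_self, ← sq]
    exact mul_le_mul_of_nonneg_left hSs hM1
  nlinarith

lemma majorant (f : ℝ → ℝ) (hf : Continuous f) :
    ∃ g : ℝ → ℝ, Continuous g ∧ ∀ X, ∀ s ∈ Set.Icc 0 X, |f s| ≤ g X := by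
  refine ⟨fun X => sSup ((fun s => |f (X * s)|) '' Set.Icc 0 1), ?_, ?_⟩
  · exact IsCompact.continuous_sSup (f := fun X s => |f (X * s)|) isCompact_Icc
      (by unfold Function.HasUncurry.uncurry; simp [Function.hasUncurryInduction]; fun_prop)
  · intro X s hs
    apply le_csSup
    · exact (isCompact_Icc.image (by fun_prop)).bddAbove
    · rcases hs with ⟨h0, h1⟩
      rcases eq_or_lt_of_le (h0.trans h1) with h | h
      · refine ⟨0, by simp, ?_⟩
        have : s = 0 := le_antisymm (h ▸ h1) h0
        simp [this]
      · refine ⟨s / X, ⟨by positivity, (div_le_one h).2 h1⟩, ?_⟩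
        simp only
        congr 2
        field_simp
/-- Embedding of the time slice. -/
noncomputable def emb (t : ℝ) (x : Fin 2 → ℝ) : Fin 3 → ℝ := ![t, x 0, x 1]

lemma emb_add_space (t : ℝ) (x : Fin 2 → ℝ) (j : Fin 2) (s : ℝ) :
    emb t (x + s • Pi.single j 1) = emb t x + s • Pi.single j.succ 1 := by
  ext k
  fin_cases j <;> fin_cases k <;> simp [emb]

lemma emb_add_time (t s : ℝ) (x : Fin 2 → ℝ) :
    emb s x = emb t x + (s - t) • Pi.single 0 1 := by
  ext k
  fin_cases k <;> simp [emb]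

lemma emb_self (w : Fin 3 → ℝ) : emb (w 0) ![w 1, w 2] = w := by
  ext k
  fin_cases k <;> simp [emb]

lemma emb_continuous : Continuous (fun p : ℝ × (Fin 2 → ℝ) => emb p.1 p.2) := by
  refine continuous_pi fun k => ?_
  fin_cases k <;> simp [emb] <;> fun_prop

lemma emb_continuous_space (t : ℝ) : Continuous (emb t) :=
  emb_continuous.comp (Continuous.prodMk_right t)

lemma emb_space (f : (Fin 3 → ℝ) → ℝ) (hf : Differentiable ℝ f) (t : ℝ) (x : Fin 2 → ℝ)
    (j : Fin 2) :
    HasLineDerivAt ℝ (fun x => f (emb t x)) (pd j.succ f (emb t x)) x (Pi.single j 1) := by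
  have h := (hf (emb t x)).hasFDerivAt.hasLineDerivAt (Pi.single j.succ 1)
  unfold HasLineDerivAt at h ⊢
  simp only [emb_add_space]
  exact h

lemma emb_time (f : (Fin 3 → ℝ) → ℝ) (hf : Differentiable ℝ f) (t : ℝ) (x : Fin 2 → ℝ) :
    HasDerivAt (fun s => f (emb s x)) (pd 0 f (emb t x)) t := by
  have h1 : HasDerivAt (fun s => emb s x) (Pi.single 0 1) t := by
    have : HasDerivAt (fun s : ℝ => emb t x + (s - t) • (Pi.single 0 1 : Fin 3 → ℝ))
        ((1:ℝ) • (Pi.single 0 1 : Fin 3 → ℝ)) t :=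
      (((hasDerivAt_id t).sub_const t).smul_const _).const_add _
    rw [one_smul] at this
    refine this.congr_of_eventuallyEq (Filter.Eventually.of_forall fun s => emb_add_time t s x)
  exact (hf (emb t x)).hasFDerivAt.comp_hasDerivAt t h1

lemma pd_continuous {f : (Fin 3 → ℝ) → ℝ} (hf : ContDiff ℝ (⊤ : ℕ∞) f) (i : Fin 3) :
    Continuous (pd i f) :=
  (hf.continuous_fderiv (by simp)).clm_apply continuous_const

lemma param_deriv {f : (Fin 3 → ℝ) → ℝ} (hf : ContDiff ℝ (⊤ : ℕ∞) f) {K : Set (Fin 2 → ℝ)}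
    (hK : IsCompact K) (t : ℝ) :
    HasDerivAt (fun t => ∫ x in K, f (emb t x)) (∫ x in K, pd 0 f (emb t x)) t := by
  have hc : Continuous (fun p : ℝ × (Fin 2 → ℝ) => pd 0 f (emb p.1 p.2)) :=
    (pd_continuous hf 0).comp emb_continuous
  obtain ⟨M, hM⟩ := ((isCompact_Icc (a := t - 1) (b := t + 1)).prod hK).exists_bound_of_continuousOn
    hc.continuousOn
  refine (hasDerivAt_integral_of_dominated_loc_of_deriv_le (bound := fun _ => M)
    (s := Set.Icc (t-1) (t+1)) (F := fun t x => f (emb t x)) (F' := fun t x => pd 0 f (emb t x))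
    (Icc_mem_nhds (by linarith) (by linarith)) ?_ ?_ ?_ ?_ ?_ ?_).2
  · exact Filter.Eventually.of_forall fun s =>
      (hf.continuous.comp (emb_continuous_space s)).aestronglyMeasurable
  · exact (hf.continuous.comp (emb_continuous_space t)).continuousOn.integrableOn_compact hK
  · exact ((pd_continuous hf 0).comp (emb_continuous_space t)).aestronglyMeasurable
  · rw [ae_restrict_iff' hK.measurableSet]
    exact Filter.Eventually.of_forall fun x hx s hs => hM (s, x) ⟨hs, hx⟩
  · exact continuousOn_const.integrableOn_compact hK
  · exact Filter.Eventually.of_forall fun x s _ => emb_time f (hf.differentiable (by simp)) s x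

lemma pd_zero_of_compl {f : (Fin 3 → ℝ) → ℝ} (hf : ContDiff ℝ (⊤ : ℕ∞) f) {K : Set (Fin 2 → ℝ)}
    (hK : IsCompact K) (t : ℝ) (h0 : ∀ x ∉ K, f (emb t x) = 0) (j : Fin 2) (x : Fin 2 → ℝ)
    (hx : x ∉ K) : pd j.succ f (emb t x) = 0 := by
  have h := emb_space f (hf.differentiable (by simp)) t x j
  have hev : (fun x => f (emb t x)) =ᶠ[nhds x] fun _ => 0 := by
    filter_upwards [hK.isClosed.isOpen_compl.mem_nhds hx] with y hy using h0 y hy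
  have h2 := h.congr_of_eventuallyEq hev.symm
  have h3 := (hasFDerivAt_const (𝕜 := ℝ) (0:ℝ) x).hasLineDerivAt (Pi.single j 1)
  simpa using h2.unique h3

lemma int_pd_zero {f : (Fin 3 → ℝ) → ℝ} (hf : ContDiff ℝ (⊤ : ℕ∞) f) {K : Set (Fin 2 → ℝ)}
    (hK : IsCompact K) (t : ℝ) (h0 : ∀ x ∉ K, f (emb t x) = 0) (j : Fin 2) :
    ∫ x in K, pd j.succ f (emb t x) = 0 := by
  have hz := pd_zero_of_compl hf hK t h0 j
  rw [setIntegral_eq_integral_of_forall_compl_eq_zero hz]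
  have hcs1 : HasCompactSupport (fun x => f (emb t x)) := HasCompactSupport.intro hK h0
  have hcs2 : HasCompactSupport (fun x => pd j.succ f (emb t x)) := HasCompactSupport.intro hK hz
  have i1 : Integrable (fun x => f (emb t x)) :=
    (hf.continuous.comp (emb_continuous_space t)).integrable_of_hasCompactSupport hcs1
  have i2 : Integrable (fun x => pd j.succ f (emb t x)) :=
    ((pd_continuous hf j.succ).comp (emb_continuous_space t)).integrable_of_hasCompactSupport hcs2
  have := integral_bilinear_hasLineDerivAt_right_eq_neg_left_of_integrable (μ := volume)
    (f := fun x => f (emb t x)) (f' := fun x => pd j.succ f (emb t x)) (g := fun _ => (1:ℝ))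
    (g' := fun _ => (0:ℝ)) (v := Pi.single j 1) (B := ContinuousLinearMap.mul ℝ ℝ)
    (by simpa using i2) (by simp) (by simpa using i1)
    (fun x _ => emb_space f (hf.differentiable (by simp)) t x j)
    (fun x _ => by simpa using (hasFDerivAt_const (𝕜 := ℝ) (1:ℝ) x).hasLineDerivAt (Pi.single j 1))
  simp at this
  exact this

lemma continuous_iSup_fin {X : Type*} [TopologicalSpace X] {n : ℕ} {f : Fin n → X → ℝ}
    (hf : ∀ i, Continuous (f i)) : Continuous (fun x => ⨆ i, f i x) := by
  have := IsCompact.continuous_sSup (f := fun (x : X) (i : Fin n) => f i x)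
    (isCompact_univ) (by
      rw [continuous_prod_of_discrete_right]
      exact hf)
  simp only [Set.image_univ] at this
  exact this

lemma sup_data {D : (Fin 3 → ℝ) → ℝ} (hD : Continuous D) (hD0 : ∀ w, 0 ≤ D w)
    {K : Set (Fin 2 → ℝ)} (hK : IsCompact K) (hne : K.Nonempty) {T : ℝ}
    (hz : ∀ t ∈ Set.Icc 0 T, ∀ x ∉ K, D (emb t x) = 0) :
    ∃ b : ℝ → ℝ, Continuous b ∧ ∀ t ∈ Set.Icc 0 T, (⨆ x, D (emb t x)) = b t ∧
      ∀ x, D (emb t x) ≤ b t := by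
  have hcont : ∀ t, Continuous fun x => D (emb t x) := fun t => hD.comp (emb_continuous_space t)
  refine ⟨fun t => sSup ((fun x => D (emb t x)) '' K),
    IsCompact.continuous_sSup (f := fun t x => D (emb t x)) hK (hD.comp emb_continuous), ?_⟩
  intro t ht
  have hb : BddAbove ((fun x => D (emb t x)) '' K) := (hK.image (hcont t)).bddAbove
  have hle : ∀ x, D (emb t x) ≤ sSup ((fun x => D (emb t x)) '' K) := by
    intro x
    by_cases hx : x ∈ K
    · exact le_csSup hb ⟨x, hx, rfl⟩
    · rw [hz t ht x hx]
      obtain ⟨y, hy⟩ := hne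
      exact (hD0 _).trans (le_csSup hb ⟨y, hy, rfl⟩)
  refine ⟨le_antisymm (ciSup_le hle) ?_, hle⟩
  refine csSup_le (hne.image _) ?_
  rintro _ ⟨x, _, rfl⟩
  exact le_ciSup (f := fun x => D (emb t x)) ⟨_, by rintro _ ⟨x, rfl⟩; exact hle x⟩ x

lemma sup_A {N : (Fin 3 → ℝ) → ℝ} (hN : Continuous N) 
    {K : Set (Fin 2 → ℝ)} (hK : IsCompact K) {T : ℝ}
    (hz : ∀ t ∈ Set.Icc 0 T, ∀ x ∉ K, N (emb t x) = 0) (w : Fin 3 → ℝ)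
    (hw : w 0 ∈ Set.Icc 0 T) :
    N w ≤ ⨆ w : Fin 3 → ℝ, ⨆ _ : w 0 ∈ Set.Icc (0 : ℝ) T, N w := by
  obtain ⟨M, hM⟩ := ((isCompact_Icc (a := 0) (b := T)).prod hK).exists_bound_of_continuousOn
    (hN.comp emb_continuous).continuousOn
  have hb : BddAbove (Set.range fun w : Fin 3 → ℝ => ⨆ _ : w 0 ∈ Set.Icc (0 : ℝ) T, N w) := by
    refine ⟨max M 0, ?_⟩
    rintro _ ⟨w, rfl⟩
    simp only
    by_cases hw : w 0 ∈ Set.Icc (0:ℝ) T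
    · rw [ciSup_pos hw, ← emb_self w]
      by_cases hx : ![w 1, w 2] ∈ K
      · exact (le_abs_self _).trans ((hM (w 0, ![w 1, w 2]) ⟨hw, hx⟩).trans (le_max_left _ _))
      · rw [hz _ hw _ hx]; exact le_max_right _ _
    · rw [ciSup_neg hw]; simp
  have := le_ciSup hb w
  simp only [ciSup_pos hw] at this
  exact this

lemma gronwall_aux {E E' b : ℝ → ℝ} {k T : ℝ} (hE : ∀ t, HasDerivAt E (E' t) t)
    (hb : Continuous b) (h : ∀ t ∈ Set.Icc 0 T, E' t ≤ k * b t * E t) {t : ℝ}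
    (ht : t ∈ Set.Icc 0 T) : E t ≤ Real.exp (k * ∫ s in (0:ℝ)..t, b s) * E 0 := by
  set I : ℝ → ℝ := fun t => ∫ s in (0:ℝ)..t, b s with hI
  have hId : ∀ t, HasDerivAt I (b t) t := fun t =>
    intervalIntegral.integral_hasDerivAt_right (hb.intervalIntegrable _ _)
      (hb.stronglyMeasurableAtFilter _ _) hb.continuousAt
  have hg : ∀ t, HasDerivAt (fun t => E t * Real.exp (-(k * I t)))
      (E' t * Real.exp (-(k * I t)) + E t * (Real.exp (-(k * I t)) * (-(k * b t)))) t := fun t =>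
    (hE t).mul (((hId t).const_mul k).neg.exp)
  have hanti := antitoneOn_of_deriv_nonpos (convex_Icc 0 T)
    (fun t _ => (hg t).continuousAt.continuousWithinAt)
    (fun t _ => (hg t).differentiableAt.differentiableWithinAt)
    (fun t ht => by
      rw [(hg t).deriv]
      have := h t (interior_subset ht)
      have h2 := mul_le_mul_of_nonneg_right this (Real.exp_pos (-(k * I t))).le
      linarith)
  have := hanti ⟨le_rfl, ht.1.trans ht.2⟩ ht ht.1
  simp only [hI, intervalIntegral.integral_same, mul_zero, neg_zero, Real.exp_zero, mul_one] at this
  rw [Real.exp_neg] at this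
  have hp := Real.exp_pos (k * ∫ s in (0:ℝ)..t, b s)
  rw [← div_eq_mul_inv, div_le_iff₀ hp] at this
  linarith
lemma pd_mul {f g : (Fin 3 → ℝ) → ℝ} (hf : Differentiable ℝ f) (hg : Differentiable ℝ g)
    (i : Fin 3) (w : Fin 3 → ℝ) :
    pd i (fun y => f y * g y) w = pd i f w * g w + f w * pd i g w := by
  unfold pd
  have := ((hf w).hasFDerivAt.mul (hg w).hasFDerivAt).fderiv
  change fderiv ℝ (fun y => f y * g y) w = _ at this
  rw [this]
  simp
  ring

lemma pd_sub {f g : (Fin 3 → ℝ) → ℝ} (hf : Differentiable ℝ f) (hg : Differentiable ℝ g)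
    (i : Fin 3) (w : Fin 3 → ℝ) :
    pd i (fun y => f y - g y) w = pd i f w - pd i g w := by
  unfold pd
  have := ((hf w).hasFDerivAt.sub (hg w).hasFDerivAt).fderiv
  change fderiv ℝ (fun y => f y - g y) w = _ at this
  rw [this]
  simp

lemma pd_add {f g : (Fin 3 → ℝ) → ℝ} (hf : Differentiable ℝ f) (hg : Differentiable ℝ g)
    (i : Fin 3) (w : Fin 3 → ℝ) :
    pd i (fun y => f y + g y) w = pd i f w + pd i g w := by
  unfold pd
  have := ((hf w).hasFDerivAt.add (hg w).hasFDerivAt).fderiv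
  change fderiv ℝ (fun y => f y + g y) w = _ at this
  rw [this]
  simp

lemma pd_comp {ψ : ℝ → ℝ} (hψ : Differentiable ℝ ψ) {f : (Fin 3 → ℝ) → ℝ}
    (hf : Differentiable ℝ f) (i : Fin 3) (w : Fin 3 → ℝ) :
    pd i (fun y => ψ (f y)) w = deriv ψ (f w) * pd i f w := by
  unfold pd
  have := ((hψ (f w)).hasDerivAt.comp_hasFDerivAt w (hf w).hasFDerivAt).fderiv
  change fderiv ℝ (fun y => ψ (f y)) w = _ at this
  rw [this]
  simp

lemma pd_sq {f : (Fin 3 → ℝ) → ℝ} (hf : Differentiable ℝ f)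
    (i : Fin 3) (w : Fin 3 → ℝ) :
    pd i (fun y => f y ^ 2) w = 2 * f w * pd i f w := by
  simp only [sq]
  rw [pd_mul hf hf]; ring

/-- The electric field component `ψ(|D|²) D_i`. -/
noncomputable def fld (ψ : ℝ → ℝ) (u : (Fin 3 → ℝ) → Fin 3 → ℝ) (i : Fin 3)
    (w : Fin 3 → ℝ) : ℝ := ψ ((u w 0) ^ 2 + (u w 1) ^ 2) * u w i

/-- Energy density for the difference. -/
noncomputable def eng (ψ : ℝ → ℝ) (u v : (Fin 3 → ℝ) → Fin 3 → ℝ) (w : Fin 3 → ℝ) : ℝ :=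
  (u w 0 - v w 0) * (fld ψ u 0 w - fld ψ v 0 w) + (u w 1 - v w 1) * (fld ψ u 1 w - fld ψ v 1 w)
    + (u w 2 - v w 2) ^ 2

/-- Flux of the energy. -/
noncomputable def flx (ψ : ℝ → ℝ) (u v : (Fin 3 → ℝ) → Fin 3 → ℝ) (i : Fin 3)
    (w : Fin 3 → ℝ) : ℝ := (u w 2 - v w 2) * (fld ψ u i w - fld ψ v i w)

lemma comp_smooth {u : (Fin 3 → ℝ) → Fin 3 → ℝ} (hu : ContDiff ℝ (⊤ : ℕ∞) u) (i : Fin 3) :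
    ContDiff ℝ (⊤ : ℕ∞) (fun w => u w i) := contDiff_pi.1 hu i

lemma fld_smooth {ψ : ℝ → ℝ} (hψ : ContDiff ℝ (⊤ : ℕ∞) ψ) {u : (Fin 3 → ℝ) → Fin 3 → ℝ}
    (hu : ContDiff ℝ (⊤ : ℕ∞) u) (i : Fin 3) : ContDiff ℝ (⊤ : ℕ∞) (fld ψ u i) :=
  (hψ.comp (((comp_smooth hu 0).pow 2).add ((comp_smooth hu 1).pow 2))).mul (comp_smooth hu i)

lemma flx_smooth {ψ : ℝ → ℝ} (hψ : ContDiff ℝ (⊤ : ℕ∞) ψ) {u v : (Fin 3 → ℝ) → Fin 3 → ℝ}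
    (hu : ContDiff ℝ (⊤ : ℕ∞) u) (hv : ContDiff ℝ (⊤ : ℕ∞) v) (i : Fin 3) :
    ContDiff ℝ (⊤ : ℕ∞) (flx ψ u v i) :=
  ((comp_smooth hu 2).sub (comp_smooth hv 2)).mul ((fld_smooth hψ hu i).sub (fld_smooth hψ hv i))

lemma eng_smooth {ψ : ℝ → ℝ} (hψ : ContDiff ℝ (⊤ : ℕ∞) ψ) {u v : (Fin 3 → ℝ) → Fin 3 → ℝ}
    (hu : ContDiff ℝ (⊤ : ℕ∞) u) (hv : ContDiff ℝ (⊤ : ℕ∞) v) :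
    ContDiff ℝ (⊤ : ℕ∞) (eng ψ u v) :=
  ((((comp_smooth hu 0).sub (comp_smooth hv 0)).mul
    ((fld_smooth hψ hu 0).sub (fld_smooth hψ hv 0))).add
  (((comp_smooth hu 1).sub (comp_smooth hv 1)).mul
    ((fld_smooth hψ hu 1).sub (fld_smooth hψ hv 1)))).add
  (((comp_smooth hu 2).sub (comp_smooth hv 2)).pow 2)

lemma pd_fld {ψ : ℝ → ℝ} (hψ : ContDiff ℝ (⊤ : ℕ∞) ψ) {u : (Fin 3 → ℝ) → Fin 3 → ℝ}
    (hu : ContDiff ℝ (⊤ : ℕ∞) u) (i k : Fin 3) (w : Fin 3 → ℝ) :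
    pd k (fld ψ u i) w = deriv ψ ((u w 0) ^ 2 + (u w 1) ^ 2) *
      (2 * u w 0 * pd k (fun y => u y 0) w + 2 * u w 1 * pd k (fun y => u y 1) w) * u w i
      + ψ ((u w 0) ^ 2 + (u w 1) ^ 2) * pd k (fun y => u y i) w := by
  have hd : ∀ i, Differentiable ℝ (fun w => u w i) := fun i =>
    (comp_smooth hu i).differentiable (by simp)
  have hψd : Differentiable ℝ ψ := hψ.differentiable (by simp)
  have hs : Differentiable ℝ (fun y => (u y 0) ^ 2 + (u y 1) ^ 2) :=
    ((hd 0).pow 2).add ((hd 1).pow 2)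
  have hps : Differentiable ℝ (fun y => ψ ((u y 0) ^ 2 + (u y 1) ^ 2)) := hψd.comp hs
  have hsq : ∀ i, Differentiable ℝ (fun y => (u y i) ^ 2) := fun i => (hd i).pow 2
  unfold fld
  rw [pd_mul hps (hd i), pd_comp hψd hs, pd_add (hsq 0) (hsq 1),
    pd_sq (hd 0), pd_sq (hd 1)]

lemma core {ψ : ℝ → ℝ} (hψ : ContDiff ℝ (⊤ : ℕ∞) ψ) {u v : (Fin 3 → ℝ) → Fin 3 → ℝ}
    (hu : ContDiff ℝ (⊤ : ℕ∞) u) (hv : ContDiff ℝ (⊤ : ℕ∞) v) {T : ℝ}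
    (su : IsMaxwellSol ψ T u) (sv : IsMaxwellSol ψ T v) (w : Fin 3 → ℝ)
    (hw : w 0 ∈ Set.Icc (0:ℝ) T) (p q p' q' a1 a2 b1 b2 d1 d2 f1 f2 : ℝ)
    (hp : p = ψ ((u w 0) ^ 2 + (u w 1) ^ 2)) (hq : q = ψ ((v w 0) ^ 2 + (v w 1) ^ 2))
    (hp' : p' = deriv ψ ((u w 0) ^ 2 + (u w 1) ^ 2))
    (hq' : q' = deriv ψ ((v w 0) ^ 2 + (v w 1) ^ 2))
    (ha1 : a1 = u w 0) (ha2 : a2 = u w 1) (hb1 : b1 = v w 0) (hb2 : b2 = v w 1)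
    (hd1 : d1 = pd 0 (fun y => u y 0) w) (hd2 : d2 = pd 0 (fun y => u y 1) w)
    (hf1 : f1 = pd 0 (fun y => v y 0) w) (hf2 : f2 = pd 0 (fun y => v y 1) w) :
    pd 0 (eng ψ u v) w = 2 * (pd 2 (flx ψ u v 0) w - pd 1 (flx ψ u v 1) w)
      - (p * ((b1-a1)*d1+(b2-a2)*d2) + 2*p'*(a1*d1+a2*d2)*(a1*(b1-a1)+a2*(b2-a2))
      - ((q*b1-p*a1)*d1 + (q*b2-p*a2)*d2))
      - (q * ((a1-b1)*f1+(a2-b2)*f2) + 2*q'*(b1*f1+b2*f2)*(b1*(a1-b1)+b2*(a2-b2))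
      - ((p*a1-q*b1)*f1 + (p*a2-q*b2)*f2)) := by
  have hud : ∀ i, Differentiable ℝ (fun w => u w i) := fun i =>
    (comp_smooth hu i).differentiable (by simp)
  have hvd : ∀ i, Differentiable ℝ (fun w => v w i) := fun i =>
    (comp_smooth hv i).differentiable (by simp)
  have hfu : ∀ i, Differentiable ℝ (fld ψ u i) := fun i =>
    (fld_smooth hψ hu i).differentiable (by simp)
  have hfv : ∀ i, Differentiable ℝ (fld ψ v i) := fun i =>
    (fld_smooth hψ hv i).differentiable (by simp)
  have dw : ∀ i, Differentiable ℝ (fun y => u y i - v y i) := fun i => (hud i).sub (hvd i)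
  have dG : ∀ i, Differentiable ℝ (fun y => fld ψ u i y - fld ψ v i y) :=
    fun i => (hfu i).sub (hfv i)
  have dwG : ∀ i, Differentiable ℝ (fun y => (u y i - v y i) * (fld ψ u i y - fld ψ v i y)) :=
    fun i => (dw i).mul (dG i)
  have dwG2 : Differentiable ℝ (fun y => (u y 0 - v y 0) * (fld ψ u 0 y - fld ψ v 0 y) +
      (u y 1 - v y 1) * (fld ψ u 1 y - fld ψ v 1 y)) := (dwG 0).add (dwG 1)
  have dsq : Differentiable ℝ (fun y => (u y 2 - v y 2) ^ 2) := (dw 2).pow 2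
  obtain ⟨s1, s2, s3⟩ := su w hw
  obtain ⟨r1, r2, r3⟩ := sv w hw
  change _ = pd 2 (fld ψ u 0) w - pd 1 (fld ψ u 1) w at s3
  change _ = pd 2 (fld ψ v 0) w - pd 1 (fld ψ v 1) w at r3
  have hflx : ∀ k i, pd k (flx ψ u v i) w = (pd k (fun y => u y 2) w - pd k (fun y => v y 2) w) *
      (fld ψ u i w - fld ψ v i w) + (u w 2 - v w 2) * (pd k (fld ψ u i) w - pd k (fld ψ v i) w) := by
    intro k i
    unfold flx
    rw [pd_mul (dw 2) (dG i), pd_sub (hud 2) (hvd 2),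
      pd_sub (hfu i) (hfv i)]
  have heng : pd 0 (eng ψ u v) w =
      ((pd 0 (fun y => u y 0) w - pd 0 (fun y => v y 0) w) * (fld ψ u 0 w - fld ψ v 0 w)
        + (u w 0 - v w 0) * (pd 0 (fld ψ u 0) w - pd 0 (fld ψ v 0) w))
      + ((pd 0 (fun y => u y 1) w - pd 0 (fun y => v y 1) w) * (fld ψ u 1 w - fld ψ v 1 w)
        + (u w 1 - v w 1) * (pd 0 (fld ψ u 1) w - pd 0 (fld ψ v 1) w))
      + 2 * (u w 2 - v w 2) * (pd 0 (fun y => u y 2) w - pd 0 (fun y => v y 2) w) := by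
    unfold eng
    rw [pd_add dwG2 dsq, pd_add (dwG 0) (dwG 1), pd_mul (dw 0) (dG 0), pd_mul (dw 1) (dG 1),
      pd_sq (dw 2), pd_sub (hud 0) (hvd 0), pd_sub (hud 1) (hvd 1),
      pd_sub (hud 2) (hvd 2), pd_sub (hfu 0) (hfv 0), pd_sub (hfu 1) (hfv 1)]
  have gu := pd_fld hψ hu
  have gv := pd_fld hψ hv
  rw [heng, hflx, hflx, s3, r3, gu 0 0 w, gu 1 0 w, gv 0 0 w, gv 1 0 w]
  have q1 : ∀ i, fld ψ u i w = p * u w i := fun i => by rw [hp]; rfl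
  have q2 : ∀ i, fld ψ v i w = q * v w i := fun i => by rw [hq]; rfl
  simp only [q1, q2, ← hp, ← hq, ← hp', ← hq', ← hd1, ← hd2, ← hf1, ← hf2]
  simp only [← ha1, ← ha2, ← hb1, ← hb2]
  rw [← hd1] at s1
  rw [← hd2] at s2
  rw [← hf1] at r1
  rw [← hf2] at r2
  have s2' : pd 1 (fun y => u y 2) w = - d2 := by linarith
  have r2' : pd 1 (fun y => v y 2) w = - f2 := by linarith
  rw [← s1, ← r1, s2', r2']
  ring
lemma not_mem_K {R : ℝ} {x : Fin 2 → ℝ} (hx : x ∉ Metric.closedBall (0 : Fin 2 → ℝ) |R|) :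
    R ≤ Real.sqrt ((x 0) ^ 2 + (x 1) ^ 2) := by
  rw [mem_closedBall_zero_iff, pi_norm_le_iff_of_nonneg (abs_nonneg R)] at hx
  push Not at hx
  obtain ⟨i, hi⟩ := hx
  rw [Real.norm_eq_abs] at hi
  have h1 : R ≤ |x i| := (le_abs_self R).trans hi.le
  refine h1.trans (Real.abs_le_sqrt ?_)
  fin_cases i
  · simp; positivity
  · simp; positivity

/-- Pointwise supremum of the spatial first derivatives. -/
noncomputable def gradSup (u : (Fin 3 → ℝ) → Fin 3 → ℝ) (w : Fin 3 → ℝ) : ℝ :=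
  ⨆ i : Fin 3, ⨆ j : Fin 2, |fderiv ℝ (fun w => u w i) w (Pi.single j.succ 1)|

lemma gradSup_continuous {u : (Fin 3 → ℝ) → Fin 3 → ℝ} (hu : ContDiff ℝ (⊤ : ℕ∞) u) :
    Continuous (gradSup u) :=
  continuous_iSup_fin fun i => continuous_iSup_fin fun j =>
    (pd_continuous (comp_smooth hu i) j.succ).abs

lemma gradSup_nonneg (u : (Fin 3 → ℝ) → Fin 3 → ℝ) (w : Fin 3 → ℝ) : 0 ≤ gradSup u w :=
  Real.iSup_nonneg fun _ => Real.iSup_nonneg fun _ => abs_nonneg _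

lemma le_gradSup (u : (Fin 3 → ℝ) → Fin 3 → ℝ) (w : Fin 3 → ℝ) (i : Fin 3) (j : Fin 2) :
    |pd j.succ (fun w => u w i) w| ≤ gradSup u w :=
  (le_ciSup (f := fun j : Fin 2 => |fderiv ℝ (fun w => u w i) w (Pi.single j.succ 1)|)
    (Set.finite_range _).bddAbove j).trans
  (le_ciSup (f := fun i : Fin 3 =>
    ⨆ j : Fin 2, |fderiv ℝ (fun w => u w i) w (Pi.single j.succ 1)|)
    (Set.finite_range _).bddAbove i)

lemma gradSup_zero {u : (Fin 3 → ℝ) → Fin 3 → ℝ} (hu : ContDiff ℝ (⊤ : ℕ∞) u)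
    {K : Set (Fin 2 → ℝ)} (hK : IsCompact K) (t : ℝ) (h0 : ∀ x ∉ K, u (emb t x) = 0)
    (x : Fin 2 → ℝ) (hx : x ∉ K) : gradSup u (emb t x) = 0 := by
  have : ∀ (i : Fin 3) (j : Fin 2),
      fderiv ℝ (fun w => u w i) (emb t x) (Pi.single j.succ 1) = 0 := fun i j =>
    pd_zero_of_compl (comp_smooth hu i) hK t (fun x hx => by rw [h0 x hx]; rfl) j x hx
  simp [gradSup, this]

lemma le_sup_A {u : (Fin 3 → ℝ) → Fin 3 → ℝ} (hu : ContDiff ℝ (⊤ : ℕ∞) u)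
    {K : Set (Fin 2 → ℝ)} (hK : IsCompact K) {T : ℝ}
    (h0 : ∀ t ∈ Set.Icc 0 T, ∀ x ∉ K, u (emb t x) = 0) (w : Fin 3 → ℝ)
    (hw : w 0 ∈ Set.Icc 0 T) (i : Fin 3) :
    |u w i| ≤ ⨆ w : Fin 3 → ℝ, ⨆ _ : w 0 ∈ Set.Icc (0 : ℝ) T, ⨆ i : Fin 3, |u w i| := by
  refine (le_ciSup (f := fun i : Fin 3 => |u w i|) (Set.finite_range _).bddAbove i).trans ?_
  refine sup_A (N := fun w => ⨆ i : Fin 3, |u w i|) ?_ hK ?_ w hw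
  · exact continuous_iSup_fin fun i => (comp_smooth hu i).continuous.abs
  · intro t ht x hx
    simp [h0 t ht x hx]

lemma energy_bounds {ψ : ℝ → ℝ} (hψ : ContDiff ℝ (⊤ : ℕ∞) ψ)
    (hψmono : MonotoneOn ψ (Set.Ici 0)) (hψ0 : ψ 0 = 1) {A M1 M2 : ℝ} (hA : 0 ≤ A)
    (hM1 : ∀ s ∈ Set.Icc 0 (2*A^2), |deriv ψ s| ≤ M1)
    (hM2 : ∀ s ∈ Set.Icc 0 (2*A^2), |deriv (deriv ψ) s| ≤ M2)
    {u v : (Fin 3 → ℝ) → Fin 3 → ℝ} {w : Fin 3 → ℝ} (h : ∀ i, |u w i| + |v w i| ≤ A) :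
    (∑ i : Fin 3, ((u w - v w) i)^2) ≤ eng ψ u v w ∧
    eng ψ u v w ≤ (ψ (2*A^2) + M1*A^2 + 1) * ∑ i : Fin 3, ((u w - v w) i)^2 ∧
    (∀ d1 d2 f1 f2 B1 B2 : ℝ, |d1| ≤ B1 → |d2| ≤ B1 → |f1| ≤ B2 → |f2| ≤ B2 →
      - (ψ ((u w 0) ^ 2 + (u w 1) ^ 2) * ((v w 0-u w 0)*d1+(v w 1-u w 1)*d2)
        + 2*deriv ψ ((u w 0) ^ 2 + (u w 1) ^ 2)*(u w 0*d1+u w 1*d2)*(u w 0*(v w 0-u w 0)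
          +u w 1*(v w 1-u w 1))
      - ((ψ ((v w 0) ^ 2 + (v w 1) ^ 2)*v w 0-ψ ((u w 0) ^ 2 + (u w 1) ^ 2)*u w 0)*d1
        + (ψ ((v w 0) ^ 2 + (v w 1) ^ 2)*v w 1-ψ ((u w 0) ^ 2 + (u w 1) ^ 2)*u w 1)*d2))
      - (ψ ((v w 0) ^ 2 + (v w 1) ^ 2) * ((u w 0-v w 0)*f1+(u w 1-v w 1)*f2)
        + 2*deriv ψ ((v w 0) ^ 2 + (v w 1) ^ 2)*(v w 0*f1+v w 1*f2)*(v w 0*(u w 0-v w 0)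
          +v w 1*(u w 1-v w 1))
      - ((ψ ((u w 0) ^ 2 + (u w 1) ^ 2)*u w 0-ψ ((v w 0) ^ 2 + (v w 1) ^ 2)*v w 0)*f1
        + (ψ ((u w 0) ^ 2 + (u w 1) ^ 2)*u w 1-ψ ((v w 0) ^ 2 + (v w 1) ^ 2)*v w 1)*f2))
      ≤ (4*A^3*M2 + 6*A*M1 + 1) * (B1 + B2) * eng ψ u v w) := by
  have hu : ∀ i, |u w i| ≤ A := fun i => by linarith [h i, abs_nonneg (v w i)]
  have hv : ∀ i, |v w i| ≤ A := fun i => by linarith [h i, abs_nonneg (u w i)]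
  have hu2 : ∀ i, (u w i)^2 ≤ A^2 := fun i => sq_le_sq.2 (by rw [abs_of_nonneg hA]; exact hu i)
  have hv2 : ∀ i, (v w i)^2 ≤ A^2 := fun i => sq_le_sq.2 (by rw [abs_of_nonneg hA]; exact hv i)
  have hS : (u w 0) ^ 2 + (u w 1) ^ 2 ∈ Set.Icc 0 (2*A^2) :=
    ⟨by positivity, by linarith [hu2 0, hu2 1]⟩
  have hs : (v w 0) ^ 2 + (v w 1) ^ 2 ∈ Set.Icc 0 (2*A^2) :=
    ⟨by positivity, by linarith [hv2 0, hv2 1]⟩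
  have hM1n : 0 ≤ M1 := (abs_nonneg _).trans (hM1 _ hS)
  have hM2n : 0 ≤ M2 := (abs_nonneg _).trans (hM2 _ hS)
  have hX : (0:ℝ) ≤ 2*A^2 := by positivity
  have hp1 : 1 ≤ ψ ((u w 0) ^ 2 + (u w 1) ^ 2) := by
    rw [← hψ0]; exact hψmono (Set.mem_Ici.2 le_rfl) (Set.mem_Ici.2 hS.1) hS.1
  have hq1 : 1 ≤ ψ ((v w 0) ^ 2 + (v w 1) ^ 2) := by
    rw [← hψ0]; exact hψmono (Set.mem_Ici.2 le_rfl) (Set.mem_Ici.2 hs.1) hs.1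
  have hpM : ψ ((u w 0) ^ 2 + (u w 1) ^ 2) ≤ ψ (2*A^2) :=
    hψmono (Set.mem_Ici.2 hS.1) (Set.mem_Ici.2 hX) hS.2
  have hqM : ψ ((v w 0) ^ 2 + (v w 1) ^ 2) ≤ ψ (2*A^2) :=
    hψmono (Set.mem_Ici.2 hs.1) (Set.mem_Ici.2 hX) hs.2
  have hmon : 0 ≤ (ψ ((u w 0) ^ 2 + (u w 1) ^ 2) - ψ ((v w 0) ^ 2 + (v w 1) ^ 2)) *
      (((u w 0) ^ 2 + (u w 1) ^ 2) - ((v w 0) ^ 2 + (v w 1) ^ 2)) := by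
    rcases le_total ((u w 0) ^ 2 + (u w 1) ^ 2) ((v w 0) ^ 2 + (v w 1) ^ 2) with hle | hle
    · exact mul_nonneg_of_nonpos_of_nonpos
        (sub_nonpos.2 (hψmono (Set.mem_Ici.2 hS.1) (Set.mem_Ici.2 hs.1) hle)) (sub_nonpos.2 hle)
    · exact mul_nonneg
        (sub_nonneg.2 (hψmono (Set.mem_Ici.2 hs.1) (Set.mem_Ici.2 hS.1) hle)) (sub_nonneg.2 hle)
  have hlow := alg_low hp1 hq1 hmon
  have hup := alg_up hpM hqM hM1n (h 0) (h 1) (taylor1 ψ hψ hM1 hS hs)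
  have hsum : ∑ i : Fin 3, ((u w - v w) i)^2
      = ((u w 0 - v w 0)^2 + (u w 1 - v w 1)^2) + (u w 2 - v w 2)^2 := by
    simp [Fin.sum_univ_three]
  have heng : eng ψ u v w = ((u w 0 - v w 0) * (ψ ((u w 0) ^ 2 + (u w 1) ^ 2) * u w 0
      - ψ ((v w 0) ^ 2 + (v w 1) ^ 2) * v w 0) + (u w 1 - v w 1) *
      (ψ ((u w 0) ^ 2 + (u w 1) ^ 2) * u w 1
      - ψ ((v w 0) ^ 2 + (v w 1) ^ 2) * v w 1)) + (u w 2 - v w 2)^2 := rfl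
  have hc2 := sq_nonneg (u w 2 - v w 2)
  have hW0 : 0 ≤ (u w 0 - v w 0)^2 + (u w 1 - v w 1)^2 := by positivity
  have hL : 1 ≤ ψ (2*A^2) + M1*A^2 + 1 := by
    have : 0 ≤ M1*A^2 := by positivity
    linarith
  rw [hsum]
  refine ⟨by rw [heng]; linarith, ?_, ?_⟩
  · rw [heng, mul_add]
    have k1 := mul_le_mul_of_nonneg_right hL hc2
    linarith
  · intro d1 d2 f1 f2 B1 B2 hd1 hd2 hf1 hf2
    have e1 := alg_rem hM2n (A := A) (by rw [add_comm]; exact h 0) (by rw [add_comm]; exact h 1)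
      hd1 hd2 (hM1 _ hS) (taylor2 ψ hψ hM2 hs hS)
    have e2 := alg_rem hM2n (h 0) (h 1) hf1 hf2 (hM1 _ hs) (taylor2 ψ hψ hM2 hS hs)
    have e1' := neg_le_of_abs_le e1
    have e2' := neg_le_of_abs_le e2
    have hB1 : 0 ≤ B1 := (abs_nonneg _).trans hd1
    have hB2 : 0 ≤ B2 := (abs_nonneg _).trans hf1
    have hWe : (u w 0 - v w 0)^2 + (u w 1 - v w 1)^2 ≤ eng ψ u v w := by rw [heng]; linarith
    have hk : 0 ≤ 4*A^3*M2 + 6*A*M1 := by positivity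
    have f := mul_le_mul_of_nonneg_left hWe (mul_nonneg hk (add_nonneg hB1 hB2))
    have g : 0 ≤ (B1 + B2) * eng ψ u v w := mul_nonneg (add_nonneg hB1 hB2) (hW0.trans hWe)
    have e3 : (v w 0 - u w 0)^2 + (v w 1 - u w 1)^2
      = (u w 0 - v w 0)^2 + (u w 1 - v w 1)^2 := by ring
    rw [e3] at e1'
    linarith
/-- `L²` Lipschitz bound for differences of two smooth, spatially compactly
supported solutions of the quasilinear 2d Maxwell system. -/
theorem statement19
    (ψ : ℝ → ℝ) (hψ : ContDiff ℝ (⊤ : ℕ∞) ψ) (hψmono : MonotoneOn ψ (Set.Ici 0))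
    (hψ0 : ψ 0 = 1) (hψnonneg : ∀ s : ℝ, 0 ≤ s → 0 ≤ ψ s) :
    ∃ C c : ℝ → ℝ, ContinuousOn C (Set.Ici 0) ∧ ContinuousOn c (Set.Ici 0) ∧
      (∀ A : ℝ, 0 ≤ A → 0 < C A ∧ 0 < c A) ∧
      ∀ (T : ℝ), 0 < T →
      ∀ (R : ℝ) (u₁ u₂ : (Fin 3 → ℝ) → Fin 3 → ℝ),
        ContDiff ℝ (⊤ : ℕ∞) u₁ → ContDiff ℝ (⊤ : ℕ∞) u₂ →
        IsMaxwellSol ψ T u₁ → IsMaxwellSol ψ T u₂ →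
        (∀ w : Fin 3 → ℝ, w 0 ∈ Set.Icc (0 : ℝ) T →
          R ≤ Real.sqrt ((w 1) ^ 2 + (w 2) ^ 2) → u₁ w = 0 ∧ u₂ w = 0) →
        (let A : ℝ :=
           (⨆ w : Fin 3 → ℝ, ⨆ _ : w 0 ∈ Set.Icc (0 : ℝ) T, ⨆ i : Fin 3, |u₁ w i|)
           + ⨆ w : Fin 3 → ℝ, ⨆ _ : w 0 ∈ Set.Icc (0 : ℝ) T, ⨆ i : Fin 3, |u₂ w i|
         let B : ℝ → ℝ := fun s =>
           (⨆ x : Fin 2 → ℝ, ⨆ i : Fin 3, ⨆ j : Fin 2,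
             |fderiv ℝ (fun w => u₁ w i) ![s, x 0, x 1] (Pi.single j.succ 1)|)
           + ⨆ x : Fin 2 → ℝ, ⨆ i : Fin 3, ⨆ j : Fin 2,
             |fderiv ℝ (fun w => u₂ w i) ![s, x 0, x 1] (Pi.single j.succ 1)|
         let v : (Fin 3 → ℝ) → Fin 3 → ℝ := fun w => u₁ w - u₂ w
         ∀ t ∈ Set.Icc (0 : ℝ) T,
           (∫ x : Fin 2 → ℝ, ∑ i : Fin 3, (v ![t, x 0, x 1] i) ^ 2)
             ≤ C A * Real.exp (c A * ∫ s in (0:ℝ)..t, B s)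
               * ∫ x : Fin 2 → ℝ, ∑ i : Fin 3, (v ![0, x 0, x 1] i) ^ 2) := by
  obtain ⟨g1, hg1c, hg1⟩ := majorant (deriv ψ) (hψ.continuous_deriv (by simp))
  have hψ' : ContDiff ℝ (⊤ : ℕ∞) (deriv ψ) := (contDiff_infty_iff_deriv.1 hψ).2
  obtain ⟨g2, hg2c, hg2⟩ := majorant (deriv (deriv ψ)) (hψ'.continuous_deriv (by simp))
  have hψc := hψ.continuous
  refine ⟨fun A => ψ (2*A^2) + g1 (2*A^2) * A^2 + 1,
    fun A => 4*A^3*g2 (2*A^2) + 6*A*g1 (2*A^2) + 1, ?_, ?_, ?_, ?_⟩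
  · exact Continuous.continuousOn (by fun_prop)
  · exact Continuous.continuousOn (by fun_prop)
  · intro A hA
    have hX : (0:ℝ) ≤ 2*A^2 := by positivity
    have n1 : 0 ≤ g1 (2*A^2) := (abs_nonneg _).trans (hg1 _ 0 ⟨le_rfl, hX⟩)
    have n2 : 0 ≤ g2 (2*A^2) := (abs_nonneg _).trans (hg2 _ 0 ⟨le_rfl, hX⟩)
    have n0 := hψnonneg _ hX
    constructor <;> positivity
  intro T hT R u₁ u₂ hu₁ hu₂ sol₁ sol₂ hsupp A B v t ht
  set K : Set (Fin 2 → ℝ) := Metric.closedBall (0 : Fin 2 → ℝ) |R| with hKdef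
  have hK : IsCompact K := isCompact_closedBall _ _
  have hKne : K.Nonempty := ⟨0, by simp [hKdef]⟩
  have hz : ∀ t ∈ Set.Icc 0 T, ∀ x ∉ K, u₁ (emb t x) = 0 ∧ u₂ (emb t x) = 0 :=
    fun t ht x hx => hsupp (emb t x) ht (not_mem_K hx)
  have hz1 : ∀ t ∈ Set.Icc 0 T, ∀ x ∉ K, u₁ (emb t x) = 0 := fun t ht x hx => (hz t ht x hx).1
  have hz2 : ∀ t ∈ Set.Icc 0 T, ∀ x ∉ K, u₂ (emb t x) = 0 := fun t ht x hx => (hz t ht x hx).2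
  have hAb : ∀ w : Fin 3 → ℝ, w 0 ∈ Set.Icc 0 T → ∀ i, |u₁ w i| + |u₂ w i| ≤ A :=
    fun w hw i => add_le_add (le_sup_A hu₁ hK hz1 w hw i) (le_sup_A hu₂ hK hz2 w hw i)
  have hA : 0 ≤ A := le_trans (by positivity)
    (hAb (emb 0 0) (show (0:ℝ) ∈ Set.Icc 0 T from ⟨le_rfl, hT.le⟩) 0)
  obtain ⟨B1, hB1c, hB1⟩ := sup_data (gradSup_continuous hu₁) (gradSup_nonneg u₁) hK hKne
    (fun t ht => gradSup_zero hu₁ hK t (hz1 t ht))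
  obtain ⟨B2, hB2c, hB2⟩ := sup_data (gradSup_continuous hu₂) (gradSup_nonneg u₂) hK hKne
    (fun t ht => gradSup_zero hu₂ hK t (hz2 t ht))
  have hBeq : ∀ s ∈ Set.Icc 0 T, B s = B1 s + B2 s := fun s hs => by
    rw [← (hB1 s hs).1, ← (hB2 s hs).1]; rfl
  have hbounds := fun (w : Fin 3 → ℝ) (hw : w 0 ∈ Set.Icc 0 T) =>
    energy_bounds hψ hψmono hψ0 hA (hg1 (2*A^2)) (hg2 (2*A^2)) (u := u₁) (v := u₂) (hAb w hw)
  have hes := eng_smooth hψ hu₁ hu₂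
  have hderiv := fun t => param_deriv hes hK t
  have hcont : ∀ {f : (Fin 3 → ℝ) → ℝ}, Continuous f → ∀ t,
      IntegrableOn (fun x => f (emb t x)) K := fun hf t =>
    (hf.comp (emb_continuous_space t)).continuousOn.integrableOn_compact hK
  have hgr := gronwall_aux (k := 4*A^3*g2 (2*A^2) + 6*A*g1 (2*A^2) + 1) (T := T)
    (b := fun s => B1 s + B2 s) hderiv (hB1c.add hB2c) (fun s hs => by
      have hfx := flx_smooth hψ hu₁ hu₂
      have hfz : ∀ i, ∀ x ∉ K, flx ψ u₁ u₂ i (emb s x) = 0 := fun i x hx => by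
        simp [flx, hz1 s hs x hx, hz2 s hs x hx]
      have z0 : ∫ x in K, pd 2 (flx ψ u₁ u₂ 0) (emb s x) = 0 :=
        int_pd_zero (hfx 0) hK s (hfz 0) 1
      have z1 : ∫ x in K, pd 1 (flx ψ u₁ u₂ 1) (emb s x) = 0 :=
        int_pd_zero (hfx 1) hK s (hfz 1) 0
      have i0 := hcont (pd_continuous (hfx 0) 2) s
      have i1 := hcont (pd_continuous (hfx 1) 1) s
      have ie := hcont hes.continuous s
      have i01 : IntegrableOn (fun x => 2 * (pd 2 (flx ψ u₁ u₂ 0) (emb s x)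
          - pd 1 (flx ψ u₁ u₂ 1) (emb s x))) K := (i0.sub i1).const_mul 2
      calc ∫ x in K, pd 0 (eng ψ u₁ u₂) (emb s x)
          ≤ ∫ x in K, (2 * (pd 2 (flx ψ u₁ u₂ 0) (emb s x) - pd 1 (flx ψ u₁ u₂ 1) (emb s x))
            + (4*A^3*g2 (2*A^2) + 6*A*g1 (2*A^2) + 1) * (B1 s + B2 s) * eng ψ u₁ u₂ (emb s x)) := by
            refine setIntegral_mono (hcont (pd_continuous hes 0) s)
              (((i0.sub i1).const_mul 2).add (ie.const_mul _)) fun x => ?_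
            have hw : (emb s x) 0 ∈ Set.Icc 0 T := hs
            have hc := core hψ hu₁ hu₂ sol₁ sol₂ (emb s x) hw _ _ _ _ _ _ _ _ _ _ _ _
              rfl rfl rfl rfl rfl rfl rfl rfl rfl rfl rfl rfl
            obtain ⟨s1, s2, -⟩ := sol₁ _ hw
            obtain ⟨r1, r2, -⟩ := sol₂ _ hw
            have k := (hbounds _ hw).2.2 (pd 0 (fun y => u₁ y 0) (emb s x))
              (pd 0 (fun y => u₁ y 1) (emb s x)) (pd 0 (fun y => u₂ y 0) (emb s x))
              (pd 0 (fun y => u₂ y 1) (emb s x)) (B1 s) (B2 s)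
              (by rw [s1]; exact (le_gradSup u₁ _ 2 1).trans ((hB1 s hs).2 x))
              (by rw [s2, abs_neg]; exact (le_gradSup u₁ _ 2 0).trans ((hB1 s hs).2 x))
              (by rw [r1]; exact (le_gradSup u₂ _ 2 1).trans ((hB2 s hs).2 x))
              (by rw [r2, abs_neg]; exact (le_gradSup u₂ _ 2 0).trans ((hB2 s hs).2 x))
            simp only
            rw [hc]
            linarith
        _ = _ := by
            rw [integral_add i01 (ie.const_mul _), integral_const_mul,
              integral_const_mul, integral_sub i0 i1, z0, z1]
            ring) ht
  have hint : ∀ s ∈ Set.Icc 0 T, (∫ x : Fin 2 → ℝ, ∑ i : Fin 3, (v ![s, x 0, x 1] i) ^ 2)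
      = ∫ x in K, ∑ i : Fin 3, ((u₁ (emb s x) - u₂ (emb s x)) i) ^ 2 := fun s hs => by
    symm
    refine setIntegral_eq_integral_of_forall_compl_eq_zero fun x hx => ?_
    simp [hz1 s hs x hx, hz2 s hs x hx]
  have hvc : Continuous (fun w => ∑ i : Fin 3, ((u₁ w - u₂ w) i) ^ 2) := by
    have := hu₁.continuous
    have := hu₂.continuous
    fun_prop
  have h0 : (0:ℝ) ∈ Set.Icc 0 T := ⟨le_rfl, hT.le⟩
  have hBint : ∫ s in (0:ℝ)..t, B s = ∫ s in (0:ℝ)..t, (B1 s + B2 s) := by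
    refine intervalIntegral.integral_congr fun s hs => ?_
    rw [Set.uIcc_of_le ht.1] at hs
    exact hBeq s ⟨hs.1, hs.2.trans ht.2⟩
  rw [hint t ht, hint 0 h0, hBint]
  have up : ∫ x in K, eng ψ u₁ u₂ (emb 0 x) ≤ (ψ (2*A^2) + g1 (2*A^2) * A^2 + 1) *
      ∫ x in K, ∑ i : Fin 3, ((u₁ (emb 0 x) - u₂ (emb 0 x)) i) ^ 2 := by
    rw [← integral_const_mul]
    exact setIntegral_mono (hcont hes.continuous 0) ((hcont hvc 0).const_mul _)
      fun x => (hbounds (emb 0 x) h0).2.1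
  have low : ∫ x in K, ∑ i : Fin 3, ((u₁ (emb t x) - u₂ (emb t x)) i) ^ 2
      ≤ ∫ x in K, eng ψ u₁ u₂ (emb t x) :=
    setIntegral_mono (hcont hvc t) (hcont hes.continuous t)
      fun x => (hbounds (emb t x) ht).1
  refine low.trans (hgr.trans ?_)
  refine (mul_le_mul_of_nonneg_left up (Real.exp_pos _).le).trans (le_of_eq ?_)
  ring
end
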